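/- If T is a symmetric k-tensor on ℝ^d and X ~ N(0,I_d), then E[⟨H_k(X), T⟩ H_m(X)] equals 0 if m ≠ k and equals T if m = k. -/

import Mathlib

open MeasureTheory ProbabilityTheory

/-- The standard Gaussian measure `N(0, I_d)` on `ℝ^d`. -/
noncomputable def stdGaussian (d : ℕ) : Measure (Fin d → ℝ) :=
  Measure.pi fun _ => gaussianReal 0 1

/-- The `m`-th normalized probabilist's Hermite polynomial `h_m(t) = He_m(t)/√(m!)`. -/
noncomputable def hermiteN (m : ℕ) (t : ℝ) : ℝ :=
  (Polynomial.aeval t (Polynomial.hermite m)) / Real.sqrt (Nat.factorial m)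

/-- `c_m = E_{G ~ N(0,1)}[ReLU(G) h_m(G)]`. -/
noncomputable def reluCoeff (m : ℕ) : ℝ :=
  ∫ t, max 0 t * hermiteN m t ∂(gaussianReal 0 1)

/-- The entries of the `m`-th normalized Hermite tensor `H_m(x)` on `ℝ^d`:
`(H_m(x))_{i_1,…,i_m} = (1/√(m!)) Σ_{partitions P of [m] into singletons and pairs}`
`⊗_{{a,b} ∈ P} (−I_{i_a,i_b}) ⊗_{{c} ∈ P} x_{i_c}`.  Such partitions are encoded as
involutions `f : Fin m → Fin m` (pairs are the 2-cycles, singletons the fixed points). -/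
noncomputable def hermiteTensor (d m : ℕ) (x : Fin d → ℝ) (i : Fin m → Fin d) : ℝ :=
  (Real.sqrt (Nat.factorial m))⁻¹ *
    ∑ f ∈ Finset.univ.filter (fun f : Fin m → Fin m => ∀ a, f (f a) = a),
      ∏ a, (if f a = a then x (i a)
            else if a < f a then (if i a = i (f a) then (-1 : ℝ) else 0) else 1)

/-- The pairing `⟨H_m(x), v^{⊗m}⟩`. -/
noncomputable def hermitePairing (d m : ℕ) (x v : Fin d → ℝ) : ℝ :=
  ∑ i : Fin m → Fin d, hermiteTensor d m x i * ∏ a, v (i a)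

lemma integrable_pow_gaussianReal (n : ℕ) :
    Integrable (fun x : ℝ => x ^ n) (gaussianReal 0 1) := by
  simpa using (memLp_id_gaussianReal (μ := 0) (v := 1) n).integrable_norm_pow' |>.mono
    (by fun_prop) (ae_of_all _ fun x => by simp)

lemma integral_pow_succ_gaussianReal (n : ℕ) :
    ∫ x, x ^ (n + 1) ∂(gaussianReal 0 1) = n * ∫ x, x ^ (n - 1) ∂(gaussianReal 0 1) := by
  have hint (m : ℕ) : Integrable (fun x : ℝ => gaussianPDFReal 0 1 x * x ^ m) := by
    have h := integrable_pow_gaussianReal m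
    rw [gaussianReal_of_var_ne_zero _ one_ne_zero,
      integrable_withDensity_iff_integrable_smul' (measurable_gaussianPDF 0 1)
        (ae_of_all _ fun _ => gaussianPDF_lt_top)] at h
    simpa [toReal_gaussianPDF] using h
  have hderiv (x : ℝ) : HasDerivAt (gaussianPDFReal 0 1) (-(gaussianPDFReal 0 1 x * x)) x := by
    rw [gaussianPDFReal_def]
    have h : HasDerivAt (fun y : ℝ => -(y - 0) ^ 2 / (2 * ((1 : NNReal) : ℝ))) (-x) x := by
      have h := (((hasDerivAt_id' x).sub_const 0).fun_pow 2).fun_neg.div_const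
        (2 * ((1 : NNReal) : ℝ))
      refine h.congr_deriv ?_
      simp
      ring
    refine (h.exp.const_mul ((√(2 * Real.pi * ((1 : NNReal) : ℝ)))⁻¹)).congr_deriv ?_
    ring
  have hparts := integral_mul_deriv_eq_deriv_mul_of_integrable
    (u := fun x : ℝ => x ^ n) (u' := fun x => n * x ^ (n - 1))
    (v := gaussianPDFReal 0 1) (v' := fun x => -(gaussianPDFReal 0 1 x * x))
    (fun x _ => hasDerivAt_pow n x) (fun x _ => hderiv x)
    ((hint (n + 1)).neg.congr (ae_of_all _ fun x => by simp; ring))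
    (((hint (n - 1)).const_mul (n : ℝ)).congr (ae_of_all _ fun x => by simp; ring))
    ((hint n).congr (ae_of_all _ fun x => by simp; ring))
  simp only [integral_gaussianReal_eq_integral_smul (one_ne_zero : (1 : NNReal) ≠ 0), smul_eq_mul]
  rw [← integral_const_mul, ← neg_inj, ← integral_neg]
  refine Eq.trans (integral_congr_ae (ae_of_all _ fun x => ?_)) (hparts.trans
    (congrArg Neg.neg (integral_congr_ae (ae_of_all _ fun x => ?_))))
  · dsimp only; ring
  · dsimp only; ring

lemma integrable_monomial_stdGaussian {d : ℕ} (s : Fin d →₀ ℕ) :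
    Integrable (fun x : Fin d → ℝ => ∏ l, x l ^ s l) (stdGaussian d) :=
  Integrable.fintype_prod fun l => integrable_pow_gaussianReal (s l)

lemma integrable_eval_stdGaussian {d : ℕ} (p : MvPolynomial (Fin d) ℝ) :
    Integrable (fun x => MvPolynomial.eval x p) (stdGaussian d) := by
  simp only [MvPolynomial.eval_eq']
  exact integrable_finsetSum _ fun s _ => (integrable_monomial_stdGaussian s).const_mul _

/-- The expectation of a polynomial under the standard Gaussian measure, as a linear map. -/
noncomputable def gaussianExpectation (d : ℕ) : MvPolynomial (Fin d) ℝ →ₗ[ℝ] ℝ where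
  toFun p := ∫ x, MvPolynomial.eval x p ∂(stdGaussian d)
  map_add' p q := by
    simp only [map_add]
    exact integral_add (integrable_eval_stdGaussian p) (integrable_eval_stdGaussian q)
  map_smul' c p := by
    simp only [MvPolynomial.smul_eval, RingHom.id_apply, smul_eq_mul, integral_const_mul]

lemma gaussianExpectation_monomial {d : ℕ} (s : Fin d →₀ ℕ) (a : ℝ) :
    gaussianExpectation d (MvPolynomial.monomial s a) =
      a * ∏ l, ∫ x, x ^ s l ∂(gaussianReal 0 1) := by
  change ∫ x, MvPolynomial.eval x (MvPolynomial.monomial s a) ∂(stdGaussian d) = _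
  simp only [MvPolynomial.eval_monomial, integral_const_mul, Finsupp.prod_pow]
  congr 1
  exact integral_fintype_prod_eq_prod (fun l (x : ℝ) => x ^ s l)

/-- Gaussian integration by parts. -/
lemma gaussianExpectation_X_mul {d : ℕ} (l : Fin d) (p : MvPolynomial (Fin d) ℝ) :
    gaussianExpectation d (MvPolynomial.X l * p) =
      gaussianExpectation d (MvPolynomial.pderiv l p) := by
  induction p using MvPolynomial.induction_on' with
  | add p q hp hq => simp only [mul_add, map_add, hp, hq]
  | monomial s a =>
    rw [MvPolynomial.X, MvPolynomial.monomial_mul, MvPolynomial.pderiv_monomial,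
      gaussianExpectation_monomial, gaussianExpectation_monomial,
      ← Finset.mul_prod_erase _ _ (Finset.mem_univ l),
      ← Finset.mul_prod_erase _ _ (Finset.mem_univ l)]
    have hoff : ∏ j ∈ Finset.univ.erase l,
          ∫ x, x ^ (Finsupp.single l 1 + s : Fin d →₀ ℕ) j ∂(gaussianReal 0 1) =
        ∏ j ∈ Finset.univ.erase l,
          ∫ x, x ^ (s - Finsupp.single l 1 : Fin d →₀ ℕ) j ∂(gaussianReal 0 1) := by
      refine Finset.prod_congr rfl fun j hj => ?_
      have hj : l ≠ j := (Finset.ne_of_mem_erase hj).symm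
      simp [hj]
    rw [hoff]
    simp only [Finsupp.add_apply, Finsupp.tsub_apply, Finsupp.single_eq_same, add_comm 1 (s l),
      integral_pow_succ_gaussianReal]
    ring

open MvPolynomial

/-- The product of the creation operators `p ↦ X_l p - ∂_l p`, `l = i 0, …, i (k - 1)`, applied
to `1`: the unnormalized multivariate Hermite polynomial with multi-index `i`. -/
noncomputable def hermiteMv {d : ℕ} : (k : ℕ) → (Fin k → Fin d) → MvPolynomial (Fin d) ℝ
  | 0, _ => 1
  | k + 1, i => X (i 0) * hermiteMv k (Fin.tail i) - pderiv (i 0) (hermiteMv k (Fin.tail i))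

lemma pderiv_comm {d : ℕ} (a b : Fin d) (p : MvPolynomial (Fin d) ℝ) :
    pderiv a (pderiv b p) = pderiv b (pderiv a p) := by
  induction p using MvPolynomial.induction_on' with
  | add p q hp hq => simp only [map_add, hp, hq]
  | monomial s c =>
    rcases eq_or_ne a b with rfl | hab
    · rfl
    · simp [pderiv_monomial, tsub_right_comm, hab, hab.symm, mul_right_comm]

lemma pderiv_hermiteMv {d : ℕ} (l : Fin d) (k : ℕ) (i : Fin (k + 1) → Fin d) :
    pderiv l (hermiteMv (k + 1) i) =
      ∑ b, if l = i b then hermiteMv k (i ∘ b.succAbove) else 0 := by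
  induction k with
  | zero =>
    rw [Fin.sum_univ_succ]
    by_cases h : l = i 0
    · simp [hermiteMv, h]
    · simp [hermiteMv, pderiv_X, h, Ne.symm h]
  | succ k ih =>
    have htail (b : Fin (k + 1)) :
        hermiteMv (k + 1) (i ∘ b.succ.succAbove) =
          X (i 0) * hermiteMv k (Fin.tail i ∘ b.succAbove) -
            pderiv (i 0) (hermiteMv k (Fin.tail i ∘ b.succAbove)) := by
      have h : Fin.tail (i ∘ b.succ.succAbove) = Fin.tail i ∘ b.succAbove := by
        ext c : 1
        simp only [Fin.tail, Function.comp_apply, Fin.succ_succAbove_succ]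
      rw [hermiteMv, h]
      rfl
    rw [hermiteMv, map_sub, pderiv_mul, pderiv_comm l, Fin.sum_univ_succ, ih (Fin.tail i)]
    simp only [htail]
    have h0 : i ∘ (0 : Fin (k + 2)).succAbove = Fin.tail i := by ext; simp [Fin.tail]
    rw [h0, Finset.mul_sum, map_sum, add_sub_assoc, ← Finset.sum_sub_distrib]
    congr 1
    · by_cases h : l = i 0
      · simp [h]
      · simp [h, pderiv_X, Ne.symm h]
    · refine Finset.sum_congr rfl fun b _ => ?_
      by_cases h : l = i b.succ
      · rw [if_pos h, if_pos (show l = Fin.tail i b from h)]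
      · rw [if_neg h, if_neg (show l ≠ Fin.tail i b from h), mul_zero, map_zero, sub_zero]

/-- The pairing of the unnormalized Hermite tensor with `T`. -/
noncomputable def hermiteMvPairing {d : ℕ} (k : ℕ) (T : (Fin k → Fin d) → ℝ) :
    MvPolynomial (Fin d) ℝ :=
  ∑ j, T j • hermiteMv k j

lemma apply_insertNth_of_symmetric {α R : Type*} {k : ℕ} {T : (Fin (k + 1) → α) → R}
    (hT : ∀ σ : Equiv.Perm (Fin (k + 1)), ∀ i, T (i ∘ σ) = T i) (b : Fin (k + 1)) (l : α)
    (j : Fin k → α) : T (b.insertNth l j) = T (Fin.cons l j) := by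
  rw [← Fin.cons_comp_cycleRange, hT]

lemma pderiv_hermiteMvPairing {d k : ℕ} {T : (Fin (k + 1) → Fin d) → ℝ}
    (hT : ∀ σ : Equiv.Perm (Fin (k + 1)), ∀ i, T (i ∘ σ) = T i) (l : Fin d) :
    pderiv l (hermiteMvPairing (k + 1) T) =
      (k + 1 : ℝ) • hermiteMvPairing k (fun j => T (Fin.cons l j)) := by
  simp only [hermiteMvPairing, map_sum, Derivation.map_smul, pderiv_hermiteMv]
  simp only [Finset.smul_sum (s := (Finset.univ : Finset (Fin (k + 1))))]
  rw [Finset.sum_comm]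
  have h (b : Fin (k + 1)) :
      ∑ j : Fin (k + 1) → Fin d,
          T j • (if l = j b then hermiteMv k (j ∘ b.succAbove) else 0) =
        ∑ j : Fin k → Fin d, T (Fin.cons l j) • hermiteMv k j := by
    rw [← (Fin.insertNthEquiv (fun _ => Fin d) b).sum_comp, Fintype.sum_prod_type,
      Finset.sum_eq_single l]
    · refine Finset.sum_congr rfl fun j _ => ?_
      have hj : (b.insertNth l j : Fin (k + 1) → Fin d) ∘ b.succAbove = j := by ext; simp
      change T (b.insertNth l j) •
        (if l = (b.insertNth l j : Fin (k + 1) → Fin d) b then _ else 0) = _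
      rw [Fin.insertNth_apply_same, if_pos rfl, apply_insertNth_of_symmetric hT]
      exact congrArg (fun j => _ • hermiteMv k j) hj
    · intro c _ hc
      simp [hc.symm]
    · simp
  simp only [h, Finset.sum_const, Finset.card_univ, Fintype.card_fin]
  rw [← Nat.cast_smul_eq_nsmul ℝ]; push_cast; rfl

lemma gaussianExpectation_mul_hermiteMv_succ {d m : ℕ} (p : MvPolynomial (Fin d) ℝ)
    (i : Fin (m + 1) → Fin d) :
    gaussianExpectation d (p * hermiteMv (m + 1) i) =
      gaussianExpectation d (pderiv (i 0) p * hermiteMv m (Fin.tail i)) := by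
  rw [hermiteMv, mul_sub, map_sub, mul_left_comm, gaussianExpectation_X_mul, pderiv_mul, map_add,
    add_sub_cancel_right]

lemma gaussianExpectation_one (d : ℕ) : gaussianExpectation d 1 = 1 := by
  simpa using gaussianExpectation_monomial (0 : Fin d →₀ ℕ) 1

lemma gaussianExpectation_hermiteMv_succ {d m : ℕ} (i : Fin (m + 1) → Fin d) :
    gaussianExpectation d (hermiteMv (m + 1) i) = 0 := by
  simpa using gaussianExpectation_mul_hermiteMv_succ 1 i

lemma hermiteMvPairing_zero {d : ℕ} (T : (Fin 0 → Fin d) → ℝ) (i : Fin 0 → Fin d) :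
    hermiteMvPairing 0 T = C (T i) := by
  simp [hermiteMvPairing, hermiteMv, Subsingleton.elim default i, smul_eq_C_mul]

lemma apply_cons_comp_of_symmetric {α R : Type*} {k : ℕ} {T : (Fin (k + 1) → α) → R}
    (hT : ∀ σ : Equiv.Perm (Fin (k + 1)), ∀ i, T (i ∘ σ) = T i) (l : α)
    (σ : Equiv.Perm (Fin k)) (i : Fin k → α) :
    T (Fin.cons l (i ∘ σ)) = T (Fin.cons l i) := by
  rw [← hT (Equiv.Perm.decomposeFin.symm (0, σ)) (Fin.cons l i)]
  congr 1
  ext j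
  refine Fin.cases ?_ (fun j => ?_) j <;> simp

lemma gaussianExpectation_hermiteMvPairing_mul {d m k : ℕ} {T : (Fin k → Fin d) → ℝ}
    (hT : ∀ σ : Equiv.Perm (Fin k), ∀ i, T (i ∘ σ) = T i) (i : Fin m → Fin d) :
    gaussianExpectation d (hermiteMvPairing k T * hermiteMv m i) =
      if h : k = m then k.factorial * T (i ∘ Fin.cast h) else 0 := by
  induction m generalizing k with
  | zero =>
    cases k with
    | zero =>
      rw [hermiteMvPairing_zero T i, hermiteMv, ← smul_eq_C_mul, map_smul, gaussianExpectation_one]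
      simp
    | succ k =>
      simp [hermiteMvPairing, hermiteMv.eq_1, gaussianExpectation_hermiteMv_succ]
  | succ m ih =>
    rw [gaussianExpectation_mul_hermiteMv_succ]
    cases k with
    | zero =>
      rw [hermiteMvPairing_zero T Fin.elim0]
      simp
    | succ k =>
      rw [pderiv_hermiteMvPairing hT, smul_mul_assoc, map_smul,
        ih fun σ j => apply_cons_comp_of_symmetric hT (i 0) σ j]
      by_cases h : k = m
      · subst h
        have hi : (Fin.cons (i 0) (Fin.tail i) : Fin (k + 1) → Fin d) = i := Fin.cons_self_tail i
        simp [Nat.factorial_succ, hi, mul_assoc]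
      · simp [h]

lemma pderiv_prod {ι : Type*} {d : ℕ} [DecidableEq ι] (l : Fin d) (s : Finset ι)
    (w : ι → MvPolynomial (Fin d) ℝ) :
    pderiv l (∏ a ∈ s, w a) = ∑ b ∈ s, pderiv l (w b) * ∏ a ∈ s.erase b, w a := by
  induction s using Finset.induction_on with
  | empty => simp
  | insert a s ha ih =>
    rw [Finset.prod_insert ha, pderiv_mul, ih, Finset.sum_insert ha, Finset.erase_insert ha,
      Finset.mul_sum]
    congr 1
    refine Finset.sum_congr rfl fun b hb => ?_
    have hab : a ≠ b := fun h => ha (h ▸ hb)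
    rw [Finset.erase_insert_of_ne hab, Finset.prod_insert (by simp [ha])]
    ring

section
variable {α : Type*} [LinearOrder α] {d : ℕ}

/-- The factor contributed by `a` in the product attached to an involution `f`. -/
noncomputable def involutionWeight (i : α → Fin d) (a b : α) : MvPolynomial (Fin d) ℝ :=
  if b = a then X (i a) else if a < b then (if i a = i b then -1 else 0) else 1

lemma pderiv_involutionWeight (i : α → Fin d) (l : Fin d) (a b : α) :
    pderiv l (involutionWeight i a b) = if b = a then (if l = i a then 1 else 0) else 0 := by
  unfold involutionWeight
  split_ifs with h1 h2 <;> simp_all [pderiv_X, eq_comm]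

lemma involutionWeight_mul_swap (i : α → Fin d) {a b : α} (hab : a ≠ b) :
    involutionWeight i a b * involutionWeight i b a = -(if i a = i b then 1 else 0) := by
  unfold involutionWeight
  rcases hab.lt_or_gt with h | h
  · simp [hab, hab.symm, h, h.not_gt]
    split_ifs <;> simp
  · simp [hab, hab.symm, h, h.not_gt, eq_comm (a := i b)]
    split_ifs <;> simp

variable [Fintype α]

/-- The involutions of `α` which fix every point outside of `s`. -/
def involutionsOn (s : Finset α) : Finset (α → α) :=
  {f | (∀ a, f (f a) = a) ∧ ∀ a ∉ s, f a = a}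

/-- The sum, over the partitions of `s` into singletons and pairs, of the products which define
the Hermite tensor. -/
noncomputable def involutionSum (i : α → Fin d) (s : Finset α) : MvPolynomial (Fin d) ℝ :=
  ∑ f ∈ involutionsOn s, ∏ a ∈ s, involutionWeight i a (f a)

lemma mem_involutionsOn {s : Finset α} {f : α → α} :
    f ∈ involutionsOn s ↔ (∀ a, f (f a) = a) ∧ ∀ a ∉ s, f a = a := by
  simp [involutionsOn]

lemma involutionsOn_erase (s : Finset α) (b : α) :
    involutionsOn (s.erase b) = (involutionsOn s).filter (fun f => f b = b) := by
  ext f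
  simp only [mem_involutionsOn, Finset.mem_filter, Finset.mem_erase, not_and_or, not_not]
  constructor
  · rintro ⟨h, h'⟩
    exact ⟨⟨h, fun a ha => h' a (Or.inr ha)⟩, h' b (Or.inl rfl)⟩
  · rintro ⟨⟨h, h'⟩, hb⟩
    refine ⟨h, fun a ha => ?_⟩
    rcases ha with rfl | ha
    exacts [hb, h' a ha]

lemma pderiv_involutionSum (i : α → Fin d) (l : Fin d) (s : Finset α) :
    pderiv l (involutionSum i s) =
      ∑ b ∈ s, if l = i b then involutionSum i (s.erase b) else 0 := by
  simp only [involutionSum, map_sum, pderiv_prod]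
  rw [Finset.sum_comm]
  refine Finset.sum_congr rfl fun b _ => ?_
  rw [involutionsOn_erase, Finset.sum_filter]
  simp only [pderiv_involutionWeight]
  split_ifs with h
  · simp [ite_mul]
  · simp

lemma sum_involutionsOn_insert_apply_eq (i : α → Fin d) {a b : α} {s : Finset α} (ha : a ∉ s)
    (hb : b ∈ s) :
    ∑ f ∈ involutionsOn (insert a s) with f a = b, ∏ c ∈ insert a s, involutionWeight i c (f c) =
      -(if i a = i b then involutionSum i (s.erase b) else 0) := by
  have hab : a ≠ b := fun h => ha (h ▸ hb)
  have hw : -(if i a = i b then involutionSum i (s.erase b) else 0) =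
      ∑ f ∈ involutionsOn (s.erase b), (involutionWeight i a b * involutionWeight i b a) *
        ∏ c ∈ s.erase b, involutionWeight i c (f c) := by
    rw [involutionWeight_mul_swap i hab, ← Finset.mul_sum, involutionSum]
    split_ifs <;> simp
  rw [hw]
  refine Finset.sum_bij' (fun f _ => f ∘ Equiv.swap a b) (fun f _ => f ∘ Equiv.swap a b)
    ?_ ?_ ?_ ?_ ?_
  · intro f hf
    simp only [Finset.mem_filter, mem_involutionsOn] at hf ⊢
    obtain ⟨⟨hf, hs⟩, hfa⟩ := hf
    have hfb : f b = a := by rw [← hfa, hf]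
    grind
  · intro f hf
    simp only [Finset.mem_filter, mem_involutionsOn] at hf ⊢
    obtain ⟨hf, hs⟩ := hf
    have hfb : f b = b := hs b (by simp)
    have hfa : f a = a := hs a (by simp [ha])
    grind
  · intro f _
    ext; simp
  · intro f _
    ext; simp
  · intro f hf
    simp only [Finset.mem_filter, mem_involutionsOn] at hf
    obtain ⟨⟨hf, hs⟩, hfa⟩ := hf
    have hfb : f b = a := by rw [← hfa, hf]
    rw [Finset.prod_insert ha, ← Finset.mul_prod_erase _ _ hb, hfa, hfb, mul_assoc]
    congr 2
    refine Finset.prod_congr rfl fun c hc => ?_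
    rw [Function.comp_apply, Equiv.swap_apply_of_ne_of_ne]
    · rintro rfl; simp [ha] at hc
    · rintro rfl; simp at hc

lemma involutionSum_insert (i : α → Fin d) {a : α} {s : Finset α} (ha : a ∉ s) :
    involutionSum i (insert a s) =
      X (i a) * involutionSum i s - pderiv (i a) (involutionSum i s) := by
  have hmaps : ∀ f ∈ involutionsOn (insert a s), f a ∈ insert a s := by
    intro f hf
    rw [mem_involutionsOn] at hf
    by_contra h
    have h' : f a = a := (hf.2 _ h).symm.trans (hf.1 a)
    exact h (by rw [h']; exact Finset.mem_insert_self a s)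
  rw [involutionSum, ← Finset.sum_fiberwise_of_maps_to hmaps, Finset.sum_insert ha,
    ← involutionsOn_erase, Finset.erase_insert ha, pderiv_involutionSum, sub_eq_add_neg,
    ← Finset.sum_neg_distrib]
  congr 1
  · rw [involutionSum, Finset.mul_sum]
    refine Finset.sum_congr rfl fun f hf => ?_
    rw [Finset.prod_insert ha, (mem_involutionsOn.1 hf).2 a ha]
    simp [involutionWeight]
  · exact Finset.sum_congr rfl fun b hb => sum_involutionsOn_insert_apply_eq i ha hb

lemma involutionSum_map (i : α → Fin d) {k : ℕ} (e : Fin k ↪ α) :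
    involutionSum i (Finset.univ.map e) = hermiteMv k (i ∘ e) := by
  induction k with
  | zero =>
    have h : involutionsOn (∅ : Finset α) = {id} := by
      ext f
      simp only [mem_involutionsOn, Finset.mem_singleton, funext_iff]
      refine ⟨fun h a => h.2 a (by simp), fun h => ⟨fun a => by simp [h], fun a _ => h a⟩⟩
    simp [involutionSum, hermiteMv, h]
  | succ k ih =>
    rw [Fin.univ_succ, Finset.map_cons, Finset.cons_eq_insert, involutionSum_insert _ (by simp),
      Finset.map_map, ih]
    rfl

end

lemma hermiteTensor_eq (d m : ℕ) (x : Fin d → ℝ) (i : Fin m → Fin d) :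
    hermiteTensor d m x i = (Real.sqrt (Nat.factorial m))⁻¹ * eval x (hermiteMv m i) := by
  have h := involutionSum_map i (Function.Embedding.refl (Fin m))
  rw [Finset.map_refl] at h
  change _ = hermiteMv m i at h
  rw [hermiteTensor, ← h, involutionSum, map_sum]
  congr 1
  refine Finset.sum_congr (by ext; simp [involutionsOn]) fun f _ => ?_
  rw [map_prod]
  refine Finset.prod_congr rfl fun a _ => ?_
  unfold involutionWeight
  split_ifs <;> simp

lemma integral_hermiteTensor_pairing_mul {d k m : ℕ} (T : (Fin k → Fin d) → ℝ)
    (i : Fin m → Fin d) :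
    ∫ x, (∑ j : Fin k → Fin d, hermiteTensor d k x j * T j) * hermiteTensor d m x i
        ∂(stdGaussian d) =
      (Real.sqrt k.factorial)⁻¹ * (Real.sqrt m.factorial)⁻¹ *
        gaussianExpectation d (hermiteMvPairing k T * hermiteMv m i) := by
  change _ = _ * ∫ x, eval x (hermiteMvPairing k T * hermiteMv m i) ∂(stdGaussian d)
  rw [← integral_const_mul]
  congr 1
  ext x
  simp only [hermiteTensor_eq, hermiteMvPairing, map_mul, map_sum, smul_eval, mul_assoc,
    ← Finset.mul_sum]
  simp only [mul_comm (T _)]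
  ring

/-- If `T` is a symmetric `k`-tensor on `ℝ^d` and `X ~ N(0,I_d)`, then
`E[⟨H_k(X), T⟩ H_m(X)]` equals `0` if `m ≠ k` and equals `T` if `m = k`. -/
theorem hermite_tensor_orthogonality (d k m : ℕ) (T : (Fin k → Fin d) → ℝ)
    (hT : ∀ σ : Equiv.Perm (Fin k), ∀ i : Fin k → Fin d, T (i ∘ σ) = T i) :
    (m ≠ k → ∀ i : Fin m → Fin d,
      ∫ x, (∑ j : Fin k → Fin d, hermiteTensor d k x j * T j) * hermiteTensor d m x i
        ∂(stdGaussian d) = 0) ∧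
    (∀ i : Fin k → Fin d,
      ∫ x, (∑ j : Fin k → Fin d, hermiteTensor d k x j * T j) * hermiteTensor d k x i
        ∂(stdGaussian d) = T i) := by
  refine ⟨fun hmk i => ?_, fun i => ?_⟩
  · rw [integral_hermiteTensor_pairing_mul, gaussianExpectation_hermiteMvPairing_mul hT,
      dif_neg hmk.symm, mul_zero]
  · rw [integral_hermiteTensor_pairing_mul, gaussianExpectation_hermiteMvPairing_mul hT,
      dif_pos rfl, ← mul_inv, Real.mul_self_sqrt (Nat.cast_nonneg _),
      inv_mul_cancel_left₀ (Nat.cast_ne_zero.2 k.factorial_ne_zero)]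
    rfl
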